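/- Let R be an extension of a non-trivial finite group G by T = {t₁, t₂} such that G^l_t = G for every t ∈ T and both t₁ and t₂ are self-dual (t̄ᵢ = tᵢ). Then there exist a, b, c, d ∈ ℕ with t₁ × t₁ = ∑_{g∈G} g + a t₁ + b t₂, t₂ × t₂ = ∑_{g∈G} g + c t₁ + d t₂, t₁ × t₂ = t₂ × t₁ = b t₁ + c t₂, and these satisfy b(b − d) + c(c − a) = |G|. -/

import Mathlib

/-- A fusion ring, given by its finite basis `B`, unit, involution (dual) and
structure constants `N a b c` (the coefficient of `c` in `a × b`). -/
structure FusionData (B : Type*) [Fintype B] [DecidableEq B] where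
  one : B
  dual : B → B
  N : B → B → B → ℕ
  dual_dual : ∀ a, dual (dual a) = a
  N_one_left : ∀ a c, N one a c = if a = c then 1 else 0
  N_one_right : ∀ a c, N a one c = if a = c then 1 else 0
  assoc : ∀ a b c d, ∑ e, N a b e * N e c d = ∑ f, N b c f * N a f d
  dual_pair : ∀ a b, N a (dual b) one = if a = b then 1 else 0
  frob : ∀ a b c, N a b c = N (dual a) c b

/-- An extension of a finite group `G` by a finite set `T`: a fusion ring with
basis `G ⊔ T`, unit `1 ∈ G`, whose structure constants restrict to the group
multiplication on `G`. -/
structure GroupExt (G T : Type*) [Group G] [Fintype G] [DecidableEq G]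
    [Fintype T] [DecidableEq T] extends FusionData (G ⊕ T) where
  one_def : one = Sum.inl 1
  mul_def : ∀ g h k : G, N (Sum.inl g) (Sum.inl h) (Sum.inl k) = if g * h = k then 1 else 0
  mul_t : ∀ (g h : G) (t : T), N (Sum.inl g) (Sum.inl h) (Sum.inr t) = 0

namespace FusionData

variable {B : Type*} [Fintype B] [DecidableEq B] (R : FusionData B)

theorem N_apply_one (a b : B) : R.N a b R.one = if a = R.dual b then 1 else 0 := by
  simpa only [R.dual_dual] using R.dual_pair a (R.dual b)

theorem dual_injective : Function.Injective R.dual :=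
  Function.LeftInverse.injective R.dual_dual

theorem N_cyclic (a b c : B) : R.N a b c = R.N (R.dual c) a (R.dual b) := by
  have h := R.assoc (R.dual c) a b R.one
  simpa [N_apply_one, R.dual_injective.eq_iff] using h.symm

end FusionData

namespace GroupExt

variable {G T : Type*} [Group G] [Fintype G] [DecidableEq G] [Fintype T] [DecidableEq T]
  (E : GroupExt G T)

theorem dual_inl (g : G) : E.dual (Sum.inl g) = Sum.inl g⁻¹ := by
  have h := E.N_apply_one (Sum.inl g⁻¹) (Sum.inl g)
  rw [E.one_def, E.mul_def] at h
  by_contra hne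
  simp [Ne.symm hne] at h

theorem N_inl_inr_inl (g h : G) (t : T) : E.N (Sum.inl g) (Sum.inr t) (Sum.inl h) = 0 := by
  rw [E.frob, dual_inl, E.mul_t]

theorem sum_N_inl_mul_N_inl_inv (g : G) (t s : T) :
    ∑ u : T, E.N (Sum.inl g) (Sum.inr t) (Sum.inr u) * E.N (Sum.inl g⁻¹) (Sum.inr u) (Sum.inr s) =
      if t = s then 1 else 0 := by
  have h := E.assoc (Sum.inl g⁻¹) (Sum.inl g) (Sum.inr t) (Sum.inr s)
  have h1 := E.N_one_left (Sum.inr t) (Sum.inr s)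
  rw [E.one_def] at h1
  simpa [Fintype.sum_sum_type, E.mul_def, E.mul_t, N_inl_inr_inl, h1] using h.symm

/-- If every left stabilizer is all of `G`, then `g × t = t`. -/
theorem N_inl_inr_inr_of_stabilizer
    (hstab : ∀ (g : G) (t : T), E.N (Sum.inl g) (Sum.inr t) (Sum.inr t) ≠ 0) (g : G) (t s : T) :
    E.N (Sum.inl g) (Sum.inr t) (Sum.inr s) = if t = s then 1 else 0 := by
  have h := E.sum_N_inl_mul_N_inl_inv g⁻¹ t s
  rw [inv_inv] at h
  have hle := Finset.single_le_sum (f := fun u => E.N (Sum.inl g⁻¹) (Sum.inr t) (Sum.inr u) *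
    E.N (Sum.inl g) (Sum.inr u) (Sum.inr s)) (fun _ _ => Nat.zero_le _) (Finset.mem_univ t)
  have hpos := Nat.pos_of_ne_zero (hstab g⁻¹ t)
  have hN := (Nat.le_mul_of_pos_left (E.N (Sum.inl g) (Sum.inr t) (Sum.inr s)) hpos).trans
    (hle.trans_eq h)
  split_ifs at hN ⊢ with hts
  · subst hts
    exact le_antisymm hN (Nat.pos_of_ne_zero (hstab g t))
  · exact Nat.le_zero.mp hN

theorem N_inr_inr_inl_of_stabilizer
    (hstab : ∀ (g : G) (t : T), E.N (Sum.inl g) (Sum.inr t) (Sum.inr t) ≠ 0) (g : G) {t s : T}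
    (hs : E.dual (Sum.inr s) = Sum.inr s) :
    E.N (Sum.inr t) (Sum.inr s) (Sum.inl g) = if t = s then 1 else 0 := by
  rw [E.N_cyclic, dual_inl, hs, E.N_inl_inr_inr_of_stabilizer hstab]

end GroupExt

/-- An extension of a non-trivial group `G` by `T = {t₁, t₂}` with
`G^l_t = G` for all `t` and both `tᵢ` self-dual has fusion rules
`t₁ × t₁ = ∑ g + a t₁ + b t₂`, `t₂ × t₂ = ∑ g + c t₁ + d t₂`,
`t₁ × t₂ = t₂ × t₁ = b t₁ + c t₂`, with `b(b − d) + c(c − a) = |G|`. -/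
theorem two_particle_selfdual_rules {G T : Type*} [Group G] [Fintype G] [DecidableEq G]
    [Fintype T] [DecidableEq T] [Nonempty T] [Nontrivial G]
    (t₁ t₂ : T) (hne : t₁ ≠ t₂) (hcover : ∀ t : T, t = t₁ ∨ t = t₂)
    (E : GroupExt G T)
    (hstab : ∀ (g : G) (t : T), E.N (Sum.inl g) (Sum.inr t) (Sum.inr t) ≠ 0)
    (hsd₁ : E.dual (Sum.inr t₁) = Sum.inr t₁)
    (hsd₂ : E.dual (Sum.inr t₂) = Sum.inr t₂) :
    ∃ a b c d : ℕ,
      (∀ g : G, E.N (Sum.inr t₁) (Sum.inr t₁) (Sum.inl g) = 1) ∧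
      E.N (Sum.inr t₁) (Sum.inr t₁) (Sum.inr t₁) = a ∧
      E.N (Sum.inr t₁) (Sum.inr t₁) (Sum.inr t₂) = b ∧
      (∀ g : G, E.N (Sum.inr t₂) (Sum.inr t₂) (Sum.inl g) = 1) ∧
      E.N (Sum.inr t₂) (Sum.inr t₂) (Sum.inr t₁) = c ∧
      E.N (Sum.inr t₂) (Sum.inr t₂) (Sum.inr t₂) = d ∧
      (∀ g : G, E.N (Sum.inr t₁) (Sum.inr t₂) (Sum.inl g) = 0) ∧
      E.N (Sum.inr t₁) (Sum.inr t₂) (Sum.inr t₁) = b ∧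
      E.N (Sum.inr t₁) (Sum.inr t₂) (Sum.inr t₂) = c ∧
      (∀ g : G, E.N (Sum.inr t₂) (Sum.inr t₁) (Sum.inl g) = 0) ∧
      E.N (Sum.inr t₂) (Sum.inr t₁) (Sum.inr t₁) = b ∧
      E.N (Sum.inr t₂) (Sum.inr t₁) (Sum.inr t₂) = c ∧
      (b : ℤ) * ((b : ℤ) - (d : ℤ)) + (c : ℤ) * ((c : ℤ) - (a : ℤ)) = Fintype.card G := by
  have hg := fun g => E.N_inr_inr_inl_of_stabilizer hstab g (t := t₁) hsd₁
  have hg' := fun g => E.N_inr_inr_inl_of_stabilizer hstab g (t := t₂) hsd₂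
  have hg₁₂ := fun g => E.N_inr_inr_inl_of_stabilizer hstab g (t := t₁) hsd₂
  have hg₂₁ := fun g => E.N_inr_inr_inl_of_stabilizer hstab g (t := t₂) hsd₁
  simp only [if_true, hne, hne.symm, if_false] at hg hg' hg₁₂ hg₂₁
  have h₁₂₁ : E.N (Sum.inr t₁) (Sum.inr t₂) (Sum.inr t₁) =
      E.N (Sum.inr t₁) (Sum.inr t₁) (Sum.inr t₂) := by
    rw [E.frob, hsd₁]
  have h₂₁₁ : E.N (Sum.inr t₂) (Sum.inr t₁) (Sum.inr t₁) =
      E.N (Sum.inr t₁) (Sum.inr t₁) (Sum.inr t₂) := by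
    rw [E.N_cyclic (Sum.inr t₁) (Sum.inr t₁), hsd₁, hsd₂]
  have h₂₁₂ : E.N (Sum.inr t₂) (Sum.inr t₁) (Sum.inr t₂) =
      E.N (Sum.inr t₂) (Sum.inr t₂) (Sum.inr t₁) := by
    rw [E.frob, hsd₂]
  have h₁₂₂ : E.N (Sum.inr t₁) (Sum.inr t₂) (Sum.inr t₂) =
      E.N (Sum.inr t₂) (Sum.inr t₂) (Sum.inr t₁) := by
    rw [E.N_cyclic (Sum.inr t₂) (Sum.inr t₂), hsd₁, hsd₂]
  refine ⟨_, _, _, _, hg, rfl, rfl, hg', rfl, rfl, hg₁₂, h₁₂₁, h₁₂₂, hg₂₁, h₂₁₁, h₂₁₂, ?_⟩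
  have huniv : (Finset.univ : Finset T) = {t₁, t₂} := by
    ext t
    simpa using hcover t
  have h := E.assoc (Sum.inr t₁) (Sum.inr t₁) (Sum.inr t₂) (Sum.inr t₂)
  simp only [Fintype.sum_sum_type, huniv, Finset.sum_pair hne, hg, hg₁₂, h₁₂₁, h₁₂₂,
    E.N_inl_inr_inr_of_stabilizer hstab, if_true, mul_one, zero_mul, Finset.sum_const_zero,
    Finset.sum_const, Finset.card_univ, smul_eq_mul] at h
  zify at h
  linear_combination -h
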